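/- arXiv:2411.13864 — 10 statements merged into one kernel-verified Lean document; each statement's English description precedes it below -/
import Mathlib

section
/- Let m, n, p, q be integers with n ≥ 1 and 1 ≤ p < q ≤ m. Define ρ' ∈ ℝ^{m+n} by ρ'_i = p − 2i + 1 for 1 ≤ i ≤ p; ρ'_i = q − p − 2(i − p) + 1 for p < i ≤ q; ρ'_i = m − q − n − 2(i − q) + 1 for q < i ≤ m; and ρ'_{m+μ} = m − q + n − 2μ + 1 for 1 ≤ μ ≤ n. Set Λ₁ = ε_{p+1} − δ_n, Λ₂ = ε₁ − δ_n, Λ₃ = ε₁ − ε_q. Then −⟨Λ₁ + ρ', Λ₁⟩ = m − n − p, −⟨Λ₂ + ρ', Λ₂⟩ = m − n + p − q, and −⟨Λ₃ + ρ', Λ₃⟩ = q. -/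
open Finset

/-- The symmetric bilinear form on `ℝ^{m+n}` (1-indexed coordinates) given by
`⟨λ,μ⟩ = -Σ_{i=1}^m λ_i μ_i + Σ_{i=m+1}^{m+n} λ_i μ_i`, i.e. the form induced on weights by
`Q(X,Y) = -Str(XY)` on the Cartan subalgebra of `sl(m|n,ℂ)`. -/
def superForm (m n : ℕ) (lam mu : ℕ → ℝ) : ℝ :=
  ∑ i ∈ Finset.Icc 1 (m + n), (if i ≤ m then (-1 : ℝ) else 1) * lam i * mu i

/-- The 1-indexed standard basis vector `e_i` of `ℝ^{m+n}` (so `ε_i = stdVec i` for `i ≤ m`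
and `δ_μ = stdVec (m+μ)`). -/
def stdVec (i : ℕ) : ℕ → ℝ := fun k => if k = i then 1 else 0

/-- Twice the Weyl vector `2ρ_k` of `k^ℂ = gl(p|0) ⊕ gl(q−p|0) ⊕ sl(m−q|n)` (Case 1 of the
flag supermanifold `SU(m|n)/K` with nodes `p` and `q` circled), in 1-indexed coordinates:
`ρ'_i = p − 2i + 1` for `1 ≤ i ≤ p`; `ρ'_i = q − p − 2(i−p) + 1` for `p < i ≤ q`;
`ρ'_i = m − q − n − 2(i−q) + 1` for `q < i ≤ m`; `ρ'_{m+μ} = m − q + n − 2μ + 1`. -/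
def rhoCase1 (m n p q : ℕ) : ℕ → ℝ := fun i =>
  if i ≤ p then (p : ℝ) - 2 * (i : ℝ) + 1
  else if i ≤ q then (q : ℝ) - (p : ℝ) - 2 * ((i : ℝ) - (p : ℝ)) + 1
  else if i ≤ m then (m : ℝ) - (q : ℝ) - (n : ℝ) - 2 * ((i : ℝ) - (q : ℝ)) + 1
  else (m : ℝ) - (q : ℝ) + (n : ℝ) - 2 * ((i : ℝ) - (m : ℝ)) + 1

theorem superForm_diff (m n a b : ℕ) (f : ℕ → ℝ) (hab : a ≠ b) (ha : 1 ≤ a) (ha' : a ≤ m + n)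
    (hb : 1 ≤ b) (hb' : b ≤ m + n) :
    superForm m n (fun k => (stdVec a k - stdVec b k) + f k) (fun k => stdVec a k - stdVec b k)
      = (if a ≤ m then (-1 : ℝ) else 1) * (1 + f a)
        - (if b ≤ m then (-1 : ℝ) else 1) * (-1 + f b) := by
  unfold superForm
  rw [← Finset.sum_subset (s₁ := {a, b}), Finset.sum_pair hab]
  · simp only [stdVec, if_true, if_neg hab, if_neg hab.symm]
    ring
  · intro x hx
    simp only [Finset.mem_insert, Finset.mem_singleton] at hx
    rw [Finset.mem_Icc]
    omega
  · intro x _ hx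
    simp only [Finset.mem_insert, Finset.mem_singleton, not_or] at hx
    simp [stdVec, hx.1, hx.2]

/-- The Casimir eigenvalues of Table 1, Case 1: with `Λ₁ = ε_{p+1} − δ_n`, `Λ₂ = ε₁ − δ_n`,
`Λ₃ = ε₁ − ε_q` the highest weights of the three isotropy summands, one has
`−⟨Λ_i + ρ', Λ_i⟩ = m − n − p`, `m − n + p − q`, `q` respectively. -/
theorem casimir_case1 (m n p q : ℕ) (hn : 1 ≤ n) (hp : 1 ≤ p) (hpq : p < q) (hqm : q ≤ m) :
    -superForm m n (fun k => (stdVec (p + 1) k - stdVec (m + n) k) + rhoCase1 m n p q k)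
        (fun k => stdVec (p + 1) k - stdVec (m + n) k) = (m : ℝ) - n - p ∧
    -superForm m n (fun k => (stdVec 1 k - stdVec (m + n) k) + rhoCase1 m n p q k)
        (fun k => stdVec 1 k - stdVec (m + n) k) = (m : ℝ) - n + p - q ∧
    -superForm m n (fun k => (stdVec 1 k - stdVec q k) + rhoCase1 m n p q k)
        (fun k => stdVec 1 k - stdVec q k) = (q : ℝ) := by
  have h1 : rhoCase1 m n p q 1 = (p : ℝ) - 1 := by
    simp only [rhoCase1, if_pos hp]
    push_cast
    ring
  have h2 : rhoCase1 m n p q (p + 1) = (q : ℝ) - p - 1 := by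
    simp only [rhoCase1, if_neg (show ¬ p + 1 ≤ p by omega), if_pos (show p + 1 ≤ q by omega)]
    push_cast
    ring
  have h3 : rhoCase1 m n p q q = (p : ℝ) - q + 1 := by
    simp only [rhoCase1, if_neg (show ¬ q ≤ p by omega), if_pos (le_refl q)]
    ring
  have h4 : rhoCase1 m n p q (m + n) = (m : ℝ) - q - n + 1 := by
    simp only [rhoCase1, if_neg (show ¬ m + n ≤ p by omega), if_neg (show ¬ m + n ≤ q by omega),
      if_neg (show ¬ m + n ≤ m by omega)]
    push_cast
    ring
  refine ⟨?_, ?_, ?_⟩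
  · rw [superForm_diff m n _ _ _ (by omega) (by omega) (by omega) (by omega) (by omega), h2, h4,
      if_pos (show p + 1 ≤ m by omega), if_neg (show ¬ m + n ≤ m by omega)]
    ring
  · rw [superForm_diff m n _ _ _ (by omega) (by omega) (by omega) (by omega) (by omega), h1, h4,
      if_pos (show 1 ≤ m by omega), if_neg (show ¬ m + n ≤ m by omega)]
    ring
  · rw [superForm_diff m n _ _ _ (by omega) (by omega) (by omega) (by omega) (by omega), h1, h3,
      if_pos (show 1 ≤ m by omega), if_pos hqm]
    ring
end

section
/- Let b, c₁, c₂, c₃, x₁, x₂, x₃, c be real numbers with b = c₁ + c₂ + c₃ and x₁x₂x₃ ≠ 0. If (x₁, x₂, x₃, c) satisfies the reduced Einstein system E(b; c₁, c₂, c₃), then (c₁(x₂ + x₃) − b·x₁)(x₂ − x₃) = (c₃ − c₂)·x₁². -/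
/-- The reduced Einstein system `E(b; c₁, c₂, c₃)` in the unknowns `(x₁, x₂, x₃, c) ∈ ℝ⁴`:
the three polynomial equations
`4c·x₁x₂x₃ = 2b·x_j x_k + (b − 2c_i)·(2x_i² − (x₁² + x₂² + x₃²))` for `i = 1, 2, 3`,
where `{j, k} = {1,2,3} ∖ {i}`. -/
def EinsteinSystem (b c₁ c₂ c₃ x₁ x₂ x₃ c : ℝ) : Prop :=
  4 * c * x₁ * x₂ * x₃ = 2 * b * x₂ * x₃ + (b - 2 * c₁) * (2 * x₁ ^ 2 - (x₁ ^ 2 + x₂ ^ 2 + x₃ ^ 2)) ∧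
  4 * c * x₁ * x₂ * x₃ = 2 * b * x₁ * x₃ + (b - 2 * c₂) * (2 * x₂ ^ 2 - (x₁ ^ 2 + x₂ ^ 2 + x₃ ^ 2)) ∧
  4 * c * x₁ * x₂ * x₃ = 2 * b * x₁ * x₂ + (b - 2 * c₃) * (2 * x₃ ^ 2 - (x₁ ^ 2 + x₂ ^ 2 + x₃ ^ 2))

/-- Equation (e1) of Section 5.4.3 (cleared of denominators): any nondegenerate solution of the
reduced Einstein system with `b = c₁ + c₂ + c₃` satisfies
`(c₁(x₂ + x₃) − b·x₁)(x₂ − x₃) = (c₃ − c₂)·x₁²`. -/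
theorem einstein_e1 (b c₁ c₂ c₃ x₁ x₂ x₃ c : ℝ) (hb : b = c₁ + c₂ + c₃)
    (hx : x₁ * x₂ * x₃ ≠ 0) (hE : EinsteinSystem b c₁ c₂ c₃ x₁ x₂ x₃ c) :
    (c₁ * (x₂ + x₃) - b * x₁) * (x₂ - x₃) = (c₃ - c₂) * x₁ ^ 2 := by
  obtain ⟨_, h2, h3⟩ := hE
  subst hb
  linear_combination (h3 - h2) / 2
end

section
/- Let b, c₁, c₂, c₃, x₁, x₂, x₃, c be real numbers with b = c₁ + c₂ + c₃ and x₁x₂x₃ ≠ 0. If (x₁, x₂, x₃, c) satisfies the reduced Einstein system E(b; c₁, c₂, c₃), then (x₂ + x₃ − x₁) · (c₁(x₂ + x₃) − (c₁ + 2c₂)x₁) · (c₁(x₂ + x₃) − (c₁ + 2c₃)x₁) · (c₁(x₂ + x₃) − (c₂ + c₃)x₁) = 0. -/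
/-- The quartic factorisation of Section 5.4.3: any nondegenerate solution of the reduced
Einstein system with `b = c₁ + c₂ + c₃` satisfies
`(x₂ + x₃ − x₁)·(c₁(x₂ + x₃) − (c₁ + 2c₂)x₁)·(c₁(x₂ + x₃) − (c₁ + 2c₃)x₁)
  ·(c₁(x₂ + x₃) − (c₂ + c₃)x₁) = 0`. -/
theorem einstein_quartic (b c₁ c₂ c₃ x₁ x₂ x₃ c : ℝ) (hb : b = c₁ + c₂ + c₃)
    (hx : x₁ * x₂ * x₃ ≠ 0) (hE : EinsteinSystem b c₁ c₂ c₃ x₁ x₂ x₃ c) :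
    (x₂ + x₃ - x₁) * (c₁ * (x₂ + x₃) - (c₁ + 2 * c₂) * x₁) *
      (c₁ * (x₂ + x₃) - (c₁ + 2 * c₃) * x₁) * (c₁ * (x₂ + x₃) - (c₂ + c₃) * x₁) = 0 := by
  obtain ⟨h1, h2, h3⟩ := hE
  subst hb
  have H : (x₂ - x₃) * (c₁ * (x₂ + x₃ - x₁) - (c₂ + c₃) * x₁) + (c₂ - c₃) * x₁ ^ 2 = 0 := by
    linarith
  have Q : (x₂ + x₃ - x₁) * (c₁ * (x₂ + x₃) - (c₂ + c₃) * x₁)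
      + (c₂ - c₃) * (x₂ + x₃) * (x₂ - x₃) - (c₂ + c₃) * (x₂ - x₃) ^ 2 = 0 := by
    linarith
  linear_combination (c₁ * (x₂ + x₃ - x₁) - (c₂ + c₃) * x₁) ^ 2 * Q
    - ((c₂ - c₃) * (x₂ + x₃) * (c₁ * (x₂ + x₃ - x₁) - (c₂ + c₃) * x₁)
      - (c₂ + c₃) * (x₂ - x₃) * (c₁ * (x₂ + x₃ - x₁) - (c₂ + c₃) * x₁)
      + (c₂ + c₃) * (c₂ - c₃) * x₁ ^ 2) * H
end

section
/- Let c₁, c₂, c₃ be real numbers with c₁c₂c₃ ≠ 0, and set b = c₁ + c₂ + c₃. Then (x₁, x₂, x₃) = (c₁, c₂, c₃) together with c = 1 + (b − 2c₁)(b − 2c₂)(b − 2c₃)/(4c₁c₂c₃) satisfies the reduced Einstein system E(b; c₁, c₂, c₃); equivalently, (c₁, c₂, c₃, c) with 4c·c₁c₂c₃ = 4c₁c₂c₃ + (b − 2c₁)(b − 2c₂)(b − 2c₃) is a nondegenerate Einstein solution. -/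
/-- The solution (S4) of Section 5.4.3: with `b = c₁ + c₂ + c₃` and `c₁c₂c₃ ≠ 0`, the triple
`(c₁, c₂, c₃)` together with `c = 1 + (b − 2c₁)(b − 2c₂)(b − 2c₃)/(4c₁c₂c₃)` satisfies the
reduced Einstein system (and is a nondegenerate Einstein solution). -/
theorem einstein_S4 (b c₁ c₂ c₃ : ℝ) (hc : c₁ * c₂ * c₃ ≠ 0) (hb : b = c₁ + c₂ + c₃) :
    EinsteinSystem b c₁ c₂ c₃ c₁ c₂ c₃
      (1 + (b - 2 * c₁) * (b - 2 * c₂) * (b - 2 * c₃) / (4 * (c₁ * c₂ * c₃))) := by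
  subst hb
  have h : 4 * (1 + (c₁ + c₂ + c₃ - 2 * c₁) * (c₁ + c₂ + c₃ - 2 * c₂) * (c₁ + c₂ + c₃ - 2 * c₃) /
      (4 * (c₁ * c₂ * c₃))) * c₁ * c₂ * c₃ = 4 * (c₁ * c₂ * c₃) +
      (c₁ + c₂ + c₃ - 2 * c₁) * (c₁ + c₂ + c₃ - 2 * c₂) * (c₁ + c₂ + c₃ - 2 * c₃) := by
    have h4 : 4 * (c₁ * c₂ * c₃) ≠ 0 := mul_ne_zero (by norm_num) hc
    have h5 := div_mul_cancel₀
      ((c₁ + c₂ + c₃ - 2 * c₁) * (c₁ + c₂ + c₃ - 2 * c₂) * (c₁ + c₂ + c₃ - 2 * c₃)) h4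
    linear_combination h5
  unfold EinsteinSystem
  rw [h]
  refine ⟨?_, ?_, ?_⟩ <;> ring
end

section
/- Let t be a nonzero real number. A quadruple (x₁, x₂, x₃, c) with x₁x₂x₃ ≠ 0 satisfies the reduced Einstein system E(t; 0, 0, t) if and only if x₃ = x₁ + x₂ and c = 0. In particular, for this parameter configuration there is a continuous two-parameter family of nondegenerate Ricci-flat solutions {(x₁, x₂, x₁ + x₂, 0) : x₁x₂(x₁ + x₂) ≠ 0}. -/
/-- The Ricci-flat family `F₃` (Theorem 5.16): for `t ≠ 0`, a quadruple `(x₁, x₂, x₃, c)` with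
`x₁x₂x₃ ≠ 0` satisfies the reduced Einstein system `E(t; 0, 0, t)` if and only if
`x₃ = x₁ + x₂` and `c = 0`; in particular there is a continuous two-parameter family of
nondegenerate Ricci-flat solutions `(x₁, x₂, x₁ + x₂, 0)` with `x₁x₂(x₁ + x₂) ≠ 0`. -/
theorem ricciFlat_family_F3 (t : ℝ) (ht : t ≠ 0) :
    (∀ x₁ x₂ x₃ c : ℝ, x₁ * x₂ * x₃ ≠ 0 →
      (EinsteinSystem t 0 0 t x₁ x₂ x₃ c ↔ (x₃ = x₁ + x₂ ∧ c = 0))) ∧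
    (∀ x₁ x₂ : ℝ, x₁ * x₂ * (x₁ + x₂) ≠ 0 →
      EinsteinSystem t 0 0 t x₁ x₂ (x₁ + x₂) 0) := by
  have key : ∀ x₁ x₂ : ℝ, EinsteinSystem t 0 0 t x₁ x₂ (x₁ + x₂) 0 := by
    intro x₁ x₂
    refine ⟨?_, ?_, ?_⟩ <;> ring
  refine ⟨?_, fun x₁ x₂ _ => key x₁ x₂⟩
  intro x₁ x₂ x₃ c hx
  constructor
  · rintro ⟨h1, h2, h3⟩
    have hx2 : x₂ ≠ 0 := fun h => hx (by rw [h]; ring)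
    -- equations 1 and 3 differ by `2 t x₂ (x₁ + x₂ - x₃)`
    have hs : (t * x₂) * (x₁ + x₂ - x₃) = 0 := by linear_combination (h1 - h3) / 2
    have hs' : x₁ + x₂ - x₃ = 0 :=
      (mul_eq_zero.mp hs).resolve_left (mul_ne_zero ht hx2)
    have h : x₃ = x₁ + x₂ := by linarith
    refine ⟨h, ?_⟩
    have hc : c * (x₁ * x₂ * x₃) = 0 := by
      linear_combination h3 / 4 + t * (x₁ + x₂ + x₃) / 4 * hs'
    exact (mul_eq_zero.mp hc).resolve_right hx
  · rintro ⟨rfl, rfl⟩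
    exact key x₁ x₂
end

section
/- Let t be a nonzero real number. A quadruple (x₁, x₂, x₃, c) with x₁x₂x₃ ≠ 0 satisfies the reduced Einstein system E(t; t, 0, 0) if and only if x₁ = x₂ + x₃ and c = 0. In particular, for this parameter configuration there is a continuous two-parameter family of nondegenerate Ricci-flat solutions {(x₂ + x₃, x₂, x₃, 0) : x₂x₃(x₂ + x₃) ≠ 0}. -/
/-- The Ricci-flat family `F₁` (Theorem 5.16): for `t ≠ 0`, a quadruple `(x₁, x₂, x₃, c)` with
`x₁x₂x₃ ≠ 0` satisfies the reduced Einstein system `E(t; t, 0, 0)` if and only if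
`x₁ = x₂ + x₃` and `c = 0`; in particular there is a continuous two-parameter family of
nondegenerate Ricci-flat solutions `(x₂ + x₃, x₂, x₃, 0)` with `x₂x₃(x₂ + x₃) ≠ 0`. -/
theorem ricciFlat_family_F1 (t : ℝ) (ht : t ≠ 0) :
    (∀ x₁ x₂ x₃ c : ℝ, x₁ * x₂ * x₃ ≠ 0 →
      (EinsteinSystem t t 0 0 x₁ x₂ x₃ c ↔ (x₁ = x₂ + x₃ ∧ c = 0))) ∧
    (∀ x₂ x₃ : ℝ, x₂ * x₃ * (x₂ + x₃) ≠ 0 →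
      EinsteinSystem t t 0 0 (x₂ + x₃) x₂ x₃ 0) := by
  have key : ∀ x₂ x₃ : ℝ, EinsteinSystem t t 0 0 (x₂ + x₃) x₂ x₃ 0 := by
    intro y z
    refine ⟨?_, ?_, ?_⟩ <;> ring
  refine ⟨?_, fun y z _ => key y z⟩
  intro x y z c h
  constructor
  · rintro ⟨h1, h2, h3⟩
    have hz : z ≠ 0 := right_ne_zero_of_mul h
    have hs : (t * z) * (x - (y + z)) = 0 := by linear_combination (h1 - h2) / 2
    have hx : x = y + z := by
      rcases mul_eq_zero.mp hs with h' | h'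
      · exact absurd h' (mul_ne_zero ht hz)
      · linarith
    refine ⟨hx, ?_⟩
    have hc : c * (x * y * z) = 0 := by
      subst hx
      linear_combination h1 / 4
    exact (mul_eq_zero.mp hc).resolve_right h
  · rintro ⟨rfl, rfl⟩
    exact key y z
end

section
/- Let m, n ≥ 1 be integers with m + n ≥ 4 (and n ≥ 3 if m = n), and let p, q be integers with 1 ≤ p < q ≤ m. Put b = 2(m − n), c₁ = m − n − p, c₂ = m − n + p − q, c₃ = q. Then a quadruple (x₁, x₂, x₃, c) with x₁x₂x₃ ≠ 0 satisfies the reduced Einstein system E(b; c₁, c₂, c₃) if and only if one of the following holds for some λ ≠ 0: (1) (x₁,x₂,x₃) = λ(m−n+p, m−n+p−q, q), c = 1/λ, and (m−n+p)(m−n+p−q)q ≠ 0; (2) (x₁,x₂,x₃) = λ(m−n−p, m−n−p+q, q), c = 1/λ, and (m−n−p)(m−n−p+q)q ≠ 0; (3) (x₁,x₂,x₃) = λ(m−n−p, m−n+p−q, 2(m−n)−q), c = 1/λ, and (m−n−p)(m−n+p−q)(2(m−n)−q) ≠ 0; (4) (x₁,x₂,x₃) = λ(m−n−p, m−n+p−q,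 q), c = (1 + 2p(q−p)(m−n−q)/(q(m−n−p)(m−n+p−q)))/λ, and (m−n−p)(m−n+p−q)q ≠ 0; or (5) p = m − n, q = 2(m − n), x₃ = x₁ + x₂ and c = 0. -/
theorem einstein_real_aux (d p q : ℝ) (hp : 0 < p) (hpq : p < q)
    (x₁ x₂ x₃ c : ℝ) (hx : x₁ * x₂ * x₃ ≠ 0) :
    EinsteinSystem (2 * d) (d - p) (d + p - q) q
        x₁ x₂ x₃ c ↔
    ((∃ l : ℝ, l ≠ 0 ∧ x₁ = l * (d + p) ∧ x₂ = l * (d + p - q) ∧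
        x₃ = l * q ∧ c = 1 / l ∧
        (d + p) * (d + p - q) * q ≠ 0) ∨
     (∃ l : ℝ, l ≠ 0 ∧ x₁ = l * (d - p) ∧ x₂ = l * (d - p + q) ∧
        x₃ = l * q ∧ c = 1 / l ∧
        (d - p) * (d - p + q) * q ≠ 0) ∨
     (∃ l : ℝ, l ≠ 0 ∧ x₁ = l * (d - p) ∧ x₂ = l * (d + p - q) ∧
        x₃ = l * (2 * d - q) ∧ c = 1 / l ∧
        (d - p) * (d + p - q) * (2 * d - q) ≠ 0) ∨
     (∃ l : ℝ, l ≠ 0 ∧ x₁ = l * (d - p) ∧ x₂ = l * (d + p - q) ∧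
        x₃ = l * q ∧
        c = (1 + 2 * p * (q - p) * (d - q) /
              (q * (d - p) * (d + p - q))) / l ∧
        (d - p) * (d + p - q) * q ≠ 0) ∨
     (p = d ∧ q = 2 * d ∧ x₃ = x₁ + x₂ ∧ c = 0)) := by
  have h1 : x₁ ≠ 0 := fun h => hx (by rw [h]; ring)
  have h2 : x₂ ≠ 0 := fun h => hx (by rw [h]; ring)
  have h3 : x₃ ≠ 0 := fun h => hx (by rw [h]; ring)
  have hq : 0 < q := hp.trans hpq
  have hq0 : q ≠ 0 := hq.ne'
  have hp0 : p ≠ 0 := hp.ne'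
  have hr0 : q - p ≠ 0 := (sub_pos.2 hpq).ne'
  unfold EinsteinSystem
  constructor
  · rintro ⟨e1, e2, e3⟩
    have D23 : (q * x₂ - (d + p - q) * x₃) * (d * x₁ - (d - q) * x₂ - (q - p) * x₃) = 0 := by
      linear_combination (1 / 4) * ((q - (d + p - q)) * e1 + (d + p - q) * e2 - q * e3)
    have D13 : (q * x₁ - (d - p) * x₃) * (d * x₂ - (d - q) * x₁ - p * x₃) = 0 := by
      linear_combination (1 / 4) * ((q - (d - p)) * e2 + (d - p) * e1 - q * e3)
    have D12 : ((d + p - q) * x₁ - (d - p) * x₂) * (d * x₃ - p * x₂ - (q - p) * x₁) = 0 := by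
      linear_combination (1 / 4) * ((d + p - q - (d - p)) * e3 + (d - p) * e1 - (d + p - q) * e2)
    -- solution of type (4)
    have P4 : q * x₂ - (d + p - q) * x₃ = 0 → q * x₁ - (d - p) * x₃ = 0 →
        (∃ l : ℝ, l ≠ 0 ∧ x₁ = l * (d - p) ∧ x₂ = l * (d + p - q) ∧
        x₃ = l * q ∧
        c = (1 + 2 * p * (q - p) * (d - q) /
              (q * (d - p) * (d + p - q))) / l ∧
        (d - p) * (d + p - q) * q ≠ 0) := by
      intro a b
      obtain ⟨l, rfl⟩ : ∃ l, x₃ = l * q := ⟨x₃ / q, by field_simp⟩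
      have hl : l ≠ 0 := left_ne_zero_of_mul h3
      have ea : x₂ = l * (d + p - q) := mul_left_cancel₀ hq0 (by linear_combination a)
      have eb : x₁ = l * (d - p) := mul_left_cancel₀ hq0 (by linear_combination b)
      subst ea eb
      have n1 := right_ne_zero_of_mul h1
      have n2 := right_ne_zero_of_mul h2
      refine ⟨l, hl, rfl, rfl, rfl, ?_, mul_ne_zero (mul_ne_zero n1 n2) hq0⟩
      apply mul_left_cancel₀ (mul_ne_zero (by norm_num : (4:ℝ) ≠ 0) hx)
      trans 4 * c * (l * (d - p)) * (l * (d + p - q)) * (l * q)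
      · ring
      rw [e3]
      field_simp
      ring
    rcases mul_eq_zero.1 D23 with a | a <;> rcases mul_eq_zero.1 D13 with b | b
    · exact Or.inr (Or.inr (Or.inr (Or.inl (P4 a b))))
    · obtain ⟨l, hl3⟩ : ∃ l, x₃ = l * q := ⟨x₃ / q, by field_simp⟩
      have ea : x₂ = l * (d + p - q) := mul_left_cancel₀ hq0 (by rw [hl3] at a; linear_combination a)
      have hl : l ≠ 0 := left_ne_zero_of_mul (hl3 ▸ h3)
      have n2 : d + p - q ≠ 0 := right_ne_zero_of_mul (ea ▸ h2)
      rcases mul_eq_zero.1 D12 with g | g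
      · refine Or.inr (Or.inr (Or.inr (Or.inl (P4 a ?_))))
        apply mul_left_cancel₀ n2
        rw [hl3]
        rw [ea] at g
        linear_combination q * g
      · left
        have eb : x₁ = l * (d + p) := mul_left_cancel₀ hr0 (by
          rw [hl3, ea] at g; linear_combination -g)
        subst hl3 ea eb
        have n1 := right_ne_zero_of_mul h1
        refine ⟨l, hl, rfl, rfl, rfl, ?_, mul_ne_zero (mul_ne_zero n1 n2) hq0⟩
        apply mul_left_cancel₀ (mul_ne_zero (by norm_num : (4:ℝ) ≠ 0) hx)
        trans 4 * c * (l * (d + p)) * (l * (d + p - q)) * (l * q)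
        · ring
        rw [e3]
        field_simp
        ring
    · obtain ⟨l, hl3⟩ : ∃ l, x₃ = l * q := ⟨x₃ / q, by field_simp⟩
      have eb : x₁ = l * (d - p) := mul_left_cancel₀ hq0 (by rw [hl3] at b; linear_combination b)
      have hl : l ≠ 0 := left_ne_zero_of_mul (hl3 ▸ h3)
      have n1 : d - p ≠ 0 := right_ne_zero_of_mul (eb ▸ h1)
      rcases mul_eq_zero.1 D12 with g | g
      · refine Or.inr (Or.inr (Or.inr (Or.inl (P4 ?_ b))))
        apply mul_left_cancel₀ n1
        rw [hl3]
        rw [eb] at g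
        linear_combination -q * g
      · right; left
        have ea : x₂ = l * (d - p + q) := mul_left_cancel₀ hp0 (by
          rw [hl3, eb] at g; linear_combination -g)
        subst hl3 ea eb
        have n2 := right_ne_zero_of_mul h2
        refine ⟨l, hl, rfl, rfl, rfl, ?_, mul_ne_zero (mul_ne_zero n1 n2) hq0⟩
        apply mul_left_cancel₀ (mul_ne_zero (by norm_num : (4:ℝ) ≠ 0) hx)
        trans 4 * c * (l * (d - p)) * (l * (d - p + q)) * (l * q)
        · ring
        rw [e3]
        field_simp
        ring
    · -- the exceptional family
      have P5 : d = p → q = 2 * p → (p = d ∧ q = 2 * d ∧ x₃ = x₁ + x₂ ∧ c = 0) := by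
        intro u v
        subst u v
        have e : x₃ = x₁ + x₂ := mul_left_cancel₀ hp0 (by linear_combination -a)
        refine ⟨rfl, rfl, e, ?_⟩
        apply mul_left_cancel₀ (mul_ne_zero (by norm_num : (4:ℝ) ≠ 0) hx)
        subst e
        linear_combination e3
      by_cases n1 : d - p = 0
      · right; right; right; right
        have hd : d = p := by linarith
        refine P5 hd ?_
        subst hd
        have hb : d * (x₃ - x₂) = (q - d) * x₁ := by linear_combination -b
        have : ((q - 2 * d) * q) * x₁ = 0 := by
          linear_combination (-d) * a - (q - d) * hb
        have := (mul_eq_zero.1 ((mul_eq_zero.1 this).resolve_right h1)).resolve_right hq0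
        linarith
      by_cases n2 : d + p - q = 0
      · right; right; right; right
        have hd : q = d + p := by linarith
        subst hd
        have ha : d * (x₃ - x₁) = p * x₂ := by linear_combination -a
        have : ((d - p) * (d + p)) * x₂ = 0 := by
          linear_combination d * b + p * ha
        have := (mul_eq_zero.1 ((mul_eq_zero.1 this).resolve_right h2)).resolve_right hq0
        exact P5 (by linarith) (by linarith)
      have g : (d + p - q) * x₁ - (d - p) * x₂ = 0 := by
        rcases mul_eq_zero.1 D12 with g | g
        · exact g
        · exfalso
          have : ((d - p) * (d + p - q) * q) * x₁ = 0 := by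
            linear_combination (1 / 2) * ((d ^ 2 - p ^ 2) * a + ((d - q) * d + p * (q - p)) * b + ((d - q) * p + (q - p) * d) * g)
          exact mul_ne_zero (mul_ne_zero (mul_ne_zero n1 n2) hq0) h1 this
      right; right; left
      obtain ⟨l, hl1⟩ : ∃ l, x₁ = l * (d - p) := ⟨x₁ / (d - p), by field_simp⟩
      have ea : x₂ = l * (d + p - q) := mul_left_cancel₀ n1 (by rw [hl1] at g; linear_combination -g)
      have hl : l ≠ 0 := left_ne_zero_of_mul (hl1 ▸ h1)
      have eb : x₃ = l * (2 * d - q) := mul_left_cancel₀ hr0 (by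
        rw [hl1, ea] at a; linear_combination -a)
      subst hl1 ea eb
      have n3 := right_ne_zero_of_mul h3
      refine ⟨l, hl, rfl, rfl, rfl, ?_, mul_ne_zero (mul_ne_zero n1 n2) n3⟩
      apply mul_left_cancel₀ (mul_ne_zero (by norm_num : (4:ℝ) ≠ 0) hx)
      trans 4 * c * (l * (d - p)) * (l * (d + p - q)) * (l * (2 * d - q))
      · ring
      rw [e3]
      field_simp
      ring
  · rintro (⟨l, hl, rfl, rfl, rfl, rfl, hn⟩ | ⟨l, hl, rfl, rfl, rfl, rfl, hn⟩ |
      ⟨l, hl, rfl, rfl, rfl, rfl, hn⟩ | ⟨l, hl, rfl, rfl, rfl, rfl, hn⟩ | ⟨rfl, rfl, rfl, rfl⟩)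
    · refine ⟨?_, ?_, ?_⟩ <;> field_simp <;> ring
    · refine ⟨?_, ?_, ?_⟩ <;> field_simp <;> ring
    · refine ⟨?_, ?_, ?_⟩ <;> field_simp <;> ring
    · have n1 := right_ne_zero_of_mul h1
      have n2 := right_ne_zero_of_mul h2
      refine ⟨?_, ?_, ?_⟩ <;> field_simp <;> ring
    · refine ⟨?_, ?_, ?_⟩ <;> ring

/-- Theorem 5.16, Case 1 (`p < q ≤ m`), algebraic content: classification of nondegenerate
solutions of the reduced Einstein system with `b = 2(m−n)`,
`(c₁, c₂, c₃) = (m−n−p, m−n+p−q, q)`. -/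
theorem einstein_classification_case1 (m n p q : ℕ) (hm : 1 ≤ m) (hn : 1 ≤ n)
    (hmn : 4 ≤ m + n) (hmn' : m = n → 3 ≤ n) (hp : 1 ≤ p) (hpq : p < q) (hq : q ≤ m)
    (x₁ x₂ x₃ c : ℝ) (hx : x₁ * x₂ * x₃ ≠ 0) :
    EinsteinSystem (2 * ((m : ℝ) - n)) ((m : ℝ) - n - p) ((m : ℝ) - n + p - q) (q : ℝ)
        x₁ x₂ x₃ c ↔
    ((∃ l : ℝ, l ≠ 0 ∧ x₁ = l * ((m : ℝ) - n + p) ∧ x₂ = l * ((m : ℝ) - n + p - q) ∧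
        x₃ = l * q ∧ c = 1 / l ∧
        ((m : ℝ) - n + p) * ((m : ℝ) - n + p - q) * q ≠ 0) ∨
     (∃ l : ℝ, l ≠ 0 ∧ x₁ = l * ((m : ℝ) - n - p) ∧ x₂ = l * ((m : ℝ) - n - p + q) ∧
        x₃ = l * q ∧ c = 1 / l ∧
        ((m : ℝ) - n - p) * ((m : ℝ) - n - p + q) * q ≠ 0) ∨
     (∃ l : ℝ, l ≠ 0 ∧ x₁ = l * ((m : ℝ) - n - p) ∧ x₂ = l * ((m : ℝ) - n + p - q) ∧
        x₃ = l * (2 * ((m : ℝ) - n) - q) ∧ c = 1 / l ∧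
        ((m : ℝ) - n - p) * ((m : ℝ) - n + p - q) * (2 * ((m : ℝ) - n) - q) ≠ 0) ∨
     (∃ l : ℝ, l ≠ 0 ∧ x₁ = l * ((m : ℝ) - n - p) ∧ x₂ = l * ((m : ℝ) - n + p - q) ∧
        x₃ = l * q ∧
        c = (1 + 2 * p * ((q : ℝ) - p) * ((m : ℝ) - n - q) /
              ((q : ℝ) * ((m : ℝ) - n - p) * ((m : ℝ) - n + p - q))) / l ∧
        ((m : ℝ) - n - p) * ((m : ℝ) - n + p - q) * q ≠ 0) ∨
     ((p : ℝ) = (m : ℝ) - n ∧ (q : ℝ) = 2 * ((m : ℝ) - n) ∧ x₃ = x₁ + x₂ ∧ c = 0)) := by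
  exact einstein_real_aux ((m : ℝ) - n) p q (by exact_mod_cast hp) (by exact_mod_cast hpq)
    x₁ x₂ x₃ c hx
end

section
/- Let m, n ≥ 1 be integers with m + n ≥ 4 (and n ≥ 3 if m = n), and let p, q be integers with 1 ≤ p < m < q ≤ m + n − 1. Put b = 2(m − n), c₁ = m − n − p, c₂ = −m − n + p + q, c₃ = 2m − q. Then a quadruple (x₁, x₂, x₃, c) with x₁x₂x₃ ≠ 0 satisfies the reduced Einstein system E(b; c₁, c₂, c₃) if and only if one of the following holds for some λ ≠ 0: (1) (x₁,x₂,x₃) = λ(m−n+p, −m−n+p+q, 2m−q), c = 1/λ, with nonzero product; (2) (x₁,x₂,x₃) = λ(m−n−p, 3m−n−p−q, 2m−q), c = 1/λ, with nonzero product; (3) (x₁,x₂,x₃) = λ(m−n−p, −m−n+p+q, q−2n), c = 1/λ, with nonzero product; (4) (x₁,x₂,x₃) = λ(m−n−p, −m−n+p+q, 2m−q), c = (1 + 2p(m+n−q)(2m−p−q)/((m−n−p)(m+n−p−q)(2m−q)))/λ, with nonzero product; (5) p = n − m, q = 2m, x₁ = x₂ + x₃ and c = 0; or (6) p = m − n,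 q = 2n, x₃ = x₁ + x₂ and c = 0. -/
/-- Two of the parallel relations force `x` to be proportional to `(Q+R, P+R, P+Q)`. -/
theorem aux_par (P Q R x y z : ℝ) (hP : P ≠ 0) (hx : x ≠ 0) (hz : z ≠ 0)
    (h1 : (P + Q) * y = (P + R) * z) (h2 : (Q + R) * z = (P + Q) * x) :
    ∃ l : ℝ, l ≠ 0 ∧ x = l * (Q + R) ∧ y = l * (P + R) ∧ z = l * (P + Q) := by
  have h3 : P + Q ≠ 0 := by
    intro h
    rw [h, zero_mul] at h1 h2
    have e1 : P + R = 0 := by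
      rcases mul_eq_zero.1 h1.symm with h' | h'
      · exact h'
      · exact absurd h' hz
    have e2 : Q + R = 0 := by
      rcases mul_eq_zero.1 h2 with h' | h'
      · exact h'
      · exact absurd h' hz
    apply hP
    linarith
  refine ⟨z / (P + Q), div_ne_zero hz h3, ?_, ?_, ?_⟩
  · field_simp
    linarith
  · field_simp
    linarith
  · field_simp

/-- Two of the line relations force one of the linear factors to vanish. -/
theorem aux_line (P Q R x y z : ℝ) (hQP : P ≠ 0 ∨ Q ≠ 0) (hR : R ≠ 0 ∨ P ≠ 0)
    (h1 : (P + Q + R) * x = R * y + Q * z) (h2 : (P + Q + R) * y = P * z + R * x)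
    (h3 : (P + R) * x = (Q + R) * y ∨ (P + Q + R) * z = P * y + Q * x) :
    x + y - z = 0 ∨ x + z - y = 0 ∨ y + z - x = 0 := by
  have e : (P + Q) * (x + y - z) = 0 := by linarith
  rcases mul_eq_zero.1 e with h | h
  · have hQ : Q = -P := by linarith
    have hP : P ≠ 0 := by
      rcases hQP with h' | h'
      · exact h'
      · intro h0
        apply h'
        rw [hQ, h0, neg_zero]
    subst hQ
    rcases h3 with h3 | h3
    · left
      have : P * (x + y - z) = 0 := by linarith
      exact (mul_eq_zero.1 this).resolve_left hP
    · have e1 : (P + R) * (x + z - y) = 0 := by linarith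
      have e2 : (-P + R) * (y + z - x) = 0 := by linarith
      rcases mul_eq_zero.1 e1 with h' | h'
      · rcases mul_eq_zero.1 e2 with h'' | h''
        · exfalso
          apply hP
          linarith
        · exact Or.inr (Or.inr h'')
      · exact Or.inr (Or.inl h')
  · exact Or.inl h

/-- If `x = y + z` the system collapses to linear relations. -/
theorem aux_degen (P Q R x y z c : ℝ) (hx : x ≠ 0) (hy : y ≠ 0) (hz : z ≠ 0)
    (hu : y + z - x = 0)
    (e1 : 2 * c * x * y * z = 2 * (P + Q + R) * y * z + P * (x ^ 2 - y ^ 2 - z ^ 2))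
    (e2 : 2 * c * x * y * z = 2 * (P + Q + R) * x * z + Q * (y ^ 2 - x ^ 2 - z ^ 2))
    (e3 : 2 * c * x * y * z = 2 * (P + Q + R) * x * y + R * (z ^ 2 - x ^ 2 - y ^ 2)) :
    c * x = 2 * P + Q + R ∧ c * y = P + R ∧ c * z = P + Q := by
  have hxe : x = y + z := by linarith
  refine ⟨?_, ?_, ?_⟩
  · apply mul_right_cancel₀ (mul_ne_zero hy hz)
    subst hxe
    linarith
  · apply mul_right_cancel₀ (mul_ne_zero hx hz)
    subst hxe
    linarith
  · apply mul_right_cancel₀ (mul_ne_zero hx hy)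
    subst hxe
    linarith

/-- The four alternatives. -/
theorem aux_main (P Q R x y z c : ℝ) (hP : P ≠ 0) (hR : R ≠ 0)
    (hx : x ≠ 0) (hy : y ≠ 0) (hz : z ≠ 0)
    (e1 : 2 * c * x * y * z = 2 * (P + Q + R) * y * z + P * (x ^ 2 - y ^ 2 - z ^ 2))
    (e2 : 2 * c * x * y * z = 2 * (P + Q + R) * x * z + Q * (y ^ 2 - x ^ 2 - z ^ 2))
    (e3 : 2 * c * x * y * z = 2 * (P + Q + R) * x * y + R * (z ^ 2 - x ^ 2 - y ^ 2)) :
    (y + z - x = 0 ∨ x + z - y = 0 ∨ x + y - z = 0) ∨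
    ∃ l : ℝ, l ≠ 0 ∧ x = l * (Q + R) ∧ y = l * (P + R) ∧ z = l * (P + Q) := by
  have g1 : ((P + Q) * y - (P + R) * z) * ((P + Q + R) * x - (R * y + Q * z)) = 0 := by
    linear_combination (1 / 2) * (Q - R) * e1 + (1 / 2) * (P + R) * e2 - (1 / 2) * (P + Q) * e3
  have g2 : ((Q + R) * z - (P + Q) * x) * ((P + Q + R) * y - (P * z + R * x)) = 0 := by
    linear_combination (1 / 2) * (R - P) * e2 + (1 / 2) * (P + Q) * e3 - (1 / 2) * (Q + R) * e1
  have g3 : ((P + R) * x - (Q + R) * y) * ((P + Q + R) * z - (P * y + Q * x)) = 0 := by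
    linear_combination (1 / 2) * (P - Q) * e3 + (1 / 2) * (Q + R) * e1 - (1 / 2) * (P + R) * e2
  have k1 := mul_eq_zero.1 g1
  have k2 := mul_eq_zero.1 g2
  have k3 := mul_eq_zero.1 g3
  rw [sub_eq_zero, sub_eq_zero] at k1 k2 k3
  by_cases m1 : (P + Q) * y = (P + R) * z
  · by_cases m2 : (Q + R) * z = (P + Q) * x
    · exact Or.inr (aux_par P Q R x y z hP hx hz m1 m2)
    · by_cases m3 : (P + R) * x = (Q + R) * y
      · right
        obtain ⟨l, hl, a1, a2, a3⟩ := aux_par P R Q x z y hP hx hy (by linarith) (by linarith)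
        exact ⟨l, hl, by linarith, a3, a2⟩
      · left
        have l2 := k2.resolve_left m2
        have l3 := k3.resolve_left m3
        have := aux_line Q R P y z x (Or.inr hR) (Or.inl hP) (by linarith) (by linarith)
          (Or.inl (by linarith))
        rcases this with h | h | h
        · exact Or.inl h
        · exact Or.inr (Or.inr (by linarith))
        · exact Or.inr (Or.inl (by linarith))
  · have l1 := k1.resolve_left m1
    by_cases m2 : (Q + R) * z = (P + Q) * x
    · by_cases m3 : (P + R) * x = (Q + R) * y
      · right
        obtain ⟨l, hl, a1, a2, a3⟩ := aux_par R Q P z y x hR hz hx (by linarith) (by linarith)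
        exact ⟨l, hl, by linarith, by linarith, by linarith⟩
      · left
        have l3 := k3.resolve_left m3
        have := aux_line P R Q x z y (Or.inl hP) (Or.inr hP) (by linarith) (by linarith)
          (Or.inl (by linarith))
        rcases this with h | h | h
        · exact Or.inr (Or.inl h)
        · exact Or.inr (Or.inr h)
        · exact Or.inl (by linarith)
    · left
      have l2 := k2.resolve_left m2
      have := aux_line P Q R x y z (Or.inl hP) (Or.inr hP) l1 l2 k3
      rcases this with h | h | h
      · exact Or.inr (Or.inr h)
      · exact Or.inr (Or.inl h)
      · exact Or.inl h

/-- Theorem 5.16, Case 2 (`p < m < q`), algebraic content: classification of nondegenerate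
solutions of the reduced Einstein system with `b = 2(m−n)`,
`(c₁, c₂, c₃) = (m−n−p, −m−n+p+q, 2m−q)`. -/
theorem einstein_classification_case2 (m n p q : ℕ) (hm : 1 ≤ m) (hn : 1 ≤ n)
    (hmn : 4 ≤ m + n) (hmn' : m = n → 3 ≤ n) (hp : 1 ≤ p) (hpm : p < m) (hmq : m < q)
    (hq : q ≤ m + n - 1) (x₁ x₂ x₃ c : ℝ) (hx : x₁ * x₂ * x₃ ≠ 0) :
    EinsteinSystem (2 * ((m : ℝ) - n)) ((m : ℝ) - n - p) (-(m : ℝ) - n + p + q)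
        (2 * (m : ℝ) - q) x₁ x₂ x₃ c ↔
    ((∃ l : ℝ, l ≠ 0 ∧ x₁ = l * ((m : ℝ) - n + p) ∧ x₂ = l * (-(m : ℝ) - n + p + q) ∧
        x₃ = l * (2 * (m : ℝ) - q) ∧ c = 1 / l ∧
        ((m : ℝ) - n + p) * (-(m : ℝ) - n + p + q) * (2 * (m : ℝ) - q) ≠ 0) ∨
     (∃ l : ℝ, l ≠ 0 ∧ x₁ = l * ((m : ℝ) - n - p) ∧ x₂ = l * (3 * (m : ℝ) - n - p - q) ∧
        x₃ = l * (2 * (m : ℝ) - q) ∧ c = 1 / l ∧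
        ((m : ℝ) - n - p) * (3 * (m : ℝ) - n - p - q) * (2 * (m : ℝ) - q) ≠ 0) ∨
     (∃ l : ℝ, l ≠ 0 ∧ x₁ = l * ((m : ℝ) - n - p) ∧ x₂ = l * (-(m : ℝ) - n + p + q) ∧
        x₃ = l * ((q : ℝ) - 2 * n) ∧ c = 1 / l ∧
        ((m : ℝ) - n - p) * (-(m : ℝ) - n + p + q) * ((q : ℝ) - 2 * n) ≠ 0) ∨
     (∃ l : ℝ, l ≠ 0 ∧ x₁ = l * ((m : ℝ) - n - p) ∧ x₂ = l * (-(m : ℝ) - n + p + q) ∧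
        x₃ = l * (2 * (m : ℝ) - q) ∧
        c = (1 + 2 * p * ((m : ℝ) + n - q) * (2 * (m : ℝ) - p - q) /
              (((m : ℝ) - n - p) * ((m : ℝ) + n - p - q) * (2 * (m : ℝ) - q))) / l ∧
        ((m : ℝ) - n - p) * (-(m : ℝ) - n + p + q) * (2 * (m : ℝ) - q) ≠ 0) ∨
     ((p : ℝ) = (n : ℝ) - m ∧ (q : ℝ) = 2 * m ∧ x₁ = x₂ + x₃ ∧ c = 0) ∨
     ((p : ℝ) = (m : ℝ) - n ∧ (q : ℝ) = 2 * n ∧ x₃ = x₁ + x₂ ∧ c = 0)) := by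
  have hx1 : x₁ ≠ 0 := by
    rintro rfl
    simp at hx
  have hx2 : x₂ ≠ 0 := by
    rintro rfl
    simp at hx
  have hx3 : x₃ ≠ 0 := by
    rintro rfl
    simp at hx
  have hp0 : (0 : ℝ) < p := by exact_mod_cast hp
  have hr0 : (q : ℝ) - m - n < 0 := by
    have : q + 1 ≤ m + n := by omega
    have : (q : ℝ) + 1 ≤ m + n := by exact_mod_cast this
    linarith
  generalize (m : ℝ) = M at *
  generalize (n : ℝ) = N at *
  generalize (p : ℝ) = P at *
  generalize (q : ℝ) = q' at *
  unfold EinsteinSystem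
  constructor
  · rintro ⟨E1, E2, E3⟩
    have e1 : 2 * c * x₁ * x₂ * x₃ = 2 * (P + (2 * M - P - q') + (q' - M - N)) * x₂ * x₃
        + P * (x₁ ^ 2 - x₂ ^ 2 - x₃ ^ 2) := by linear_combination (1 / 2) * E1
    have e2 : 2 * c * x₁ * x₂ * x₃ = 2 * (P + (2 * M - P - q') + (q' - M - N)) * x₁ * x₃
        + (2 * M - P - q') * (x₂ ^ 2 - x₁ ^ 2 - x₃ ^ 2) := by linear_combination (1 / 2) * E2
    have e3 : 2 * c * x₁ * x₂ * x₃ = 2 * (P + (2 * M - P - q') + (q' - M - N)) * x₁ * x₂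
        + (q' - M - N) * (x₃ ^ 2 - x₁ ^ 2 - x₂ ^ 2) := by linear_combination (1 / 2) * E3
    rcases aux_main _ _ _ _ _ _ _ hp0.ne' hr0.ne hx1 hx2 hx3 e1 e2 e3 with
      (hu | hv | hw) | ⟨l, hl, a1, a2, a3⟩
    · obtain ⟨b1, b2, b3⟩ := aux_degen _ _ _ _ _ _ _ hx1 hx2 hx3 hu e1 e2 e3
      by_cases hc : c = 0
      · right; right; right; right; left
        subst hc
        exact ⟨by linarith, by linarith, by linarith, rfl⟩
      · left
        have d1 : M - N + P = c * x₁ := by linarith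
        have d2 : -M - N + P + q' = c * x₂ := by linarith
        have d3 : 2 * M - q' = c * x₃ := by linarith
        rw [d1, d2, d3]
        refine ⟨1 / c, one_div_ne_zero hc, ?_, ?_, ?_, ?_, ?_⟩
        · field_simp
        · field_simp
        · field_simp
        · field_simp
        · positivity
    · obtain ⟨b2, b1, b3⟩ := aux_degen (2 * M - P - q') P (q' - M - N) x₂ x₁ x₃ c hx2 hx1 hx3 hv
        (by linarith) (by linarith) (by linarith)
      have hc : c ≠ 0 := by
        rintro rfl
        linarith
      right; left
      have d1 : M - N - P = c * x₁ := by linarith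
      have d2 : 3 * M - N - P - q' = c * x₂ := by linarith
      have d3 : 2 * M - q' = c * x₃ := by linarith
      rw [d1, d2, d3]
      refine ⟨1 / c, one_div_ne_zero hc, ?_, ?_, ?_, ?_, ?_⟩
      · field_simp
      · field_simp
      · field_simp
      · field_simp
      · positivity
    · obtain ⟨b3, b1, b2⟩ := aux_degen (q' - M - N) P (2 * M - P - q') x₃ x₁ x₂ c hx3 hx1 hx2 hw
        (by linarith) (by linarith) (by linarith)
      by_cases hc : c = 0
      · right; right; right; right; right
        subst hc
        exact ⟨by linarith, by linarith, by linarith, rfl⟩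
      · right; right; left
        have d1 : M - N - P = c * x₁ := by linarith
        have d2 : -M - N + P + q' = c * x₂ := by linarith
        have d3 : q' - 2 * N = c * x₃ := by linarith
        rw [d1, d2, d3]
        refine ⟨1 / c, one_div_ne_zero hc, ?_, ?_, ?_, ?_, ?_⟩
        · field_simp
        · field_simp
        · field_simp
        · field_simp
        · positivity
    · right; right; right; left
      have a1' : x₁ = l * (M - N - P) := by linarith
      have a2' : x₂ = l * (-M - N + P + q') := by linarith
      have a3' : x₃ = l * (2 * M - q') := by linarith
      have n1 : M - N - P ≠ 0 := right_ne_zero_of_mul (a1' ▸ hx1)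
      have n2 : -M - N + P + q' ≠ 0 := right_ne_zero_of_mul (a2' ▸ hx2)
      have n3 : 2 * M - q' ≠ 0 := right_ne_zero_of_mul (a3' ▸ hx3)
      have n2' : M + N - P - q' ≠ 0 := by
        intro h
        apply n2
        linarith
      refine ⟨l, hl, a1', a2', a3', ?_, mul_ne_zero (mul_ne_zero n1 n2) n3⟩
      rw [eq_div_iff hl, ← sub_eq_iff_eq_add', eq_div_iff (mul_ne_zero (mul_ne_zero n1 n2') n3)]
      apply mul_left_cancel₀ (mul_ne_zero hl hl)
      rw [a1', a2', a3'] at e1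
      linear_combination (-1 / 2) * e1
  · rintro (⟨l, hl, a1, a2, a3, hc, -⟩ | ⟨l, hl, a1, a2, a3, hc, -⟩ | ⟨l, hl, a1, a2, a3, hc, -⟩ |
      ⟨l, hl, a1, a2, a3, hc, hn⟩ | ⟨h1, h2, h3, hc⟩ | ⟨h1, h2, h3, hc⟩)
    · subst a1 a2 a3 hc
      refine ⟨?_, ?_, ?_⟩ <;> field_simp <;> ring
    · subst a1 a2 a3 hc
      refine ⟨?_, ?_, ?_⟩ <;> field_simp <;> ring
    · subst a1 a2 a3 hc
      refine ⟨?_, ?_, ?_⟩ <;> field_simp <;> ring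
    · have n3 := right_ne_zero_of_mul hn
      have n1 := left_ne_zero_of_mul (left_ne_zero_of_mul hn)
      have n2 := right_ne_zero_of_mul (left_ne_zero_of_mul hn)
      have n2' : M + N - P - q' ≠ 0 := by
        intro h
        apply n2
        linarith
      rw [eq_div_iff hl, ← sub_eq_iff_eq_add',
        eq_div_iff (mul_ne_zero (mul_ne_zero n1 n2') n3)] at hc
      subst a1 a2 a3
      refine ⟨?_, ?_, ?_⟩
      · linear_combination (-4 * l ^ 2) * hc
      · linear_combination (-4 * l ^ 2) * hc
      · linear_combination (-4 * l ^ 2) * hc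
    · subst h1 h2 h3 hc
      refine ⟨?_, ?_, ?_⟩ <;> ring
    · subst h1 h2 h3 hc
      refine ⟨?_, ?_, ?_⟩ <;> ring
end

section
/- Let m, n ≥ 1 be integers with m + n ≥ 4 (and n ≥ 3 if m = n), and let p, q be integers with m ≤ p < q ≤ m + n − 1. Put b = 2(m − n), c₁ = p − m − n, c₂ = m − n − p + q, c₃ = 2m − q. Then a quadruple (x₁, x₂, x₃, c) with x₁x₂x₃ ≠ 0 satisfies the reduced Einstein system E(b; c₁, c₂, c₃) if and only if one of the following holds for some λ ≠ 0: (1) (x₁,x₂,x₃) = λ(3m−n−p, m−n−p+q, 2m−q), c = 1/λ, with nonzero product; (2) (x₁,x₂,x₃) = λ(p−m−n, m−n+p−q, 2m−q), c = 1/λ, with nonzero product; (3) (x₁,x₂,x₃) = λ(p−m−n, m−n−p+q, q−2n), c = 1/λ, with nonzero product; (4) (x₁,x₂,x₃) = λ(p−m−n, m−n−p+q, 2m−q), c = (1 + 2(p−q)(m+n−q)(2m−p)/((m+n−p)(m−n−p+q)(2m−q)))/λ, with nonzero product; or (5) p = 3m − n, q = 2m, x₁ = x₂ + x₃ and c = 0.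 -/
lemma core_c {P l c e1 : ℝ} (hl : l ≠ 0) (hP : P ≠ 0)
    (h : c * (l ^ 3 * P) = l ^ 2 * e1) : c = e1 / P / l := by
  field_simp
  have : l ^ 2 * (c * l * P - e1) = 0 := by linear_combination h
  rcases mul_eq_zero.mp this with h0 | h0
  · exact absurd h0 (pow_ne_zero 2 hl)
  · linarith

lemma core_forward (α β γ x y z c : ℝ) (hβ : β ≠ 0) (hγ : γ ≠ 0) (hβγ : β + γ ≠ 0)
    (hx : x * y * z ≠ 0)
    (h1 : 2 * c * x * y * z = 2 * (α + β + γ) * y * z + α * (x ^ 2 - y ^ 2 - z ^ 2))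
    (h2 : 2 * c * x * y * z = 2 * (α + β + γ) * x * z + β * (y ^ 2 - x ^ 2 - z ^ 2))
    (h3 : 2 * c * x * y * z = 2 * (α + β + γ) * x * y + γ * (z ^ 2 - x ^ 2 - y ^ 2)) :
    (∃ l : ℝ, l ≠ 0 ∧ x = l * (2 * α + β + γ) ∧ y = l * (α + γ) ∧ z = l * (α + β) ∧ c = 1 / l) ∨
    (∃ l : ℝ, l ≠ 0 ∧ x = l * (β + γ) ∧ y = l * (α + 2 * β + γ) ∧ z = l * (α + β) ∧ c = 1 / l) ∨
    (∃ l : ℝ, l ≠ 0 ∧ x = l * (β + γ) ∧ y = l * (α + γ) ∧ z = l * (α + β + 2 * γ) ∧ c = 1 / l) ∨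
    (∃ l : ℝ, l ≠ 0 ∧ x = l * (β + γ) ∧ y = l * (α + γ) ∧ z = l * (α + β) ∧
      c = (1 + 2 * α * β * γ / ((β + γ) * (α + γ) * (α + β))) / l) ∨
    (2 * α + β + γ = 0 ∧ α + β = 0 ∧ x = y + z ∧ c = 0) := by
  have hx0 : x ≠ 0 := by rintro rfl; simp at hx
  have L1 : ((α + β) * y - (α + γ) * z) * (γ * y + β * z - (α + β + γ) * x) = 0 := by
    linear_combination (-(β - γ) / 2) * h1 + (-(α + γ) / 2) * h2 + ((α + β) / 2) * h3
  have L2 : ((β + γ) * z - (α + β) * x) * (α * z + γ * x - (α + β + γ) * y) = 0 := by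
    linear_combination ((β + γ) / 2) * h1 + (-(γ - α) / 2) * h2 + (-(α + β) / 2) * h3
  have L3 : ((β + γ) * y - (α + γ) * x) * (α * y + β * x - (α + β + γ) * z) = 0 := by
    linear_combination ((β + γ) / 2) * h1 + (-(α + γ) / 2) * h2 + ((α - β) / 2) * h3
  -- the four families once the point is known
  have F1 : ∀ l, x = l * (2 * α + β + γ) → y = l * (α + γ) → z = l * (α + β) → l ≠ 0 ∧ c = 1 / l := by
    rintro l rfl rfl rfl
    have hl : l ≠ 0 := by rintro rfl; simp at hx
    have hP : (2 * α + β + γ) * (α + γ) * (α + β) ≠ 0 := by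
      intro h; apply hx; linear_combination l ^ 3 * h
    refine ⟨hl, ?_⟩
    rw [core_c (c := c) (e1 := (2 * α + β + γ) * (α + γ) * (α + β)) hl hP
      (by linear_combination h1 / 2), div_self hP]
  have F2 : ∀ l, x = l * (β + γ) → y = l * (α + 2 * β + γ) → z = l * (α + β) → l ≠ 0 ∧ c = 1 / l := by
    rintro l rfl rfl rfl
    have hl : l ≠ 0 := by rintro rfl; simp at hx
    have hP : (β + γ) * (α + 2 * β + γ) * (α + β) ≠ 0 := by
      intro h; apply hx; linear_combination l ^ 3 * h
    refine ⟨hl, ?_⟩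
    rw [core_c (c := c) (e1 := (β + γ) * (α + 2 * β + γ) * (α + β)) hl hP
      (by linear_combination h2 / 2), div_self hP]
  have F3 : ∀ l, x = l * (β + γ) → y = l * (α + γ) → z = l * (α + β + 2 * γ) → l ≠ 0 ∧ c = 1 / l := by
    rintro l rfl rfl rfl
    have hl : l ≠ 0 := by rintro rfl; simp at hx
    have hP : (β + γ) * (α + γ) * (α + β + 2 * γ) ≠ 0 := by
      intro h; apply hx; linear_combination l ^ 3 * h
    refine ⟨hl, ?_⟩
    rw [core_c (c := c) (e1 := (β + γ) * (α + γ) * (α + β + 2 * γ)) hl hP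
      (by linear_combination h3 / 2), div_self hP]
  have F4 : ∀ l, x = l * (β + γ) → y = l * (α + γ) → z = l * (α + β) →
      l ≠ 0 ∧ c = (1 + 2 * α * β * γ / ((β + γ) * (α + γ) * (α + β))) / l := by
    rintro l rfl rfl rfl
    have hl : l ≠ 0 := by rintro rfl; simp at hx
    have hP : (β + γ) * (α + γ) * (α + β) ≠ 0 := by
      intro h; apply hx; linear_combination l ^ 3 * h
    refine ⟨hl, ?_⟩
    rw [core_c (c := c) (e1 := (β + γ) * (α + γ) * (α + β) + 2 * α * β * γ) hl hP
      (by linear_combination h1 / 2), add_div, div_self hP]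
  by_contra hG
  have F4' : ∀ l, x = l * (β + γ) → y = l * (α + γ) → z = l * (α + β) → False := fun l a b d =>
    hG (Or.inr (Or.inr (Or.inr (Or.inl ⟨l, (F4 l a b d).1, a, b, d, (F4 l a b d).2⟩))))
  have F2' : ∀ l, x = l * (β + γ) → y = l * (α + 2 * β + γ) → z = l * (α + β) → False := fun l a b d =>
    hG (Or.inr (Or.inl ⟨l, (F2 l a b d).1, a, b, d, (F2 l a b d).2⟩))
  have F3' : ∀ l, x = l * (β + γ) → y = l * (α + γ) → z = l * (α + β + 2 * γ) → False := fun l a b d =>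
    hG (Or.inr (Or.inr (Or.inl ⟨l, (F3 l a b d).1, a, b, d, (F3 l a b d).2⟩)))
  obtain ⟨l, hl⟩ : ∃ l, x = l * (β + γ) := ⟨x / (β + γ), by field_simp⟩
  rcases mul_eq_zero.mp L2 with hA | hA <;> rcases mul_eq_zero.mp L3 with hB | hB
  · exact F4' l hl (mul_left_cancel₀ hβγ (by rw [hl] at hB; linear_combination hB))
      (mul_left_cancel₀ hβγ (by rw [hl] at hA; linear_combination hA))
  · have hz : z = l * (α + β) :=
      mul_left_cancel₀ hβγ (by rw [hl] at hA; linear_combination hA)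
    by_cases hα : α = 0
    · subst hα
      rcases mul_eq_zero.mp L1 with hC | hC
      · exact F4' l hl (mul_left_cancel₀ hβ (by rw [hz] at hC; linear_combination hC)) hz
      · exact F2' l hl (mul_left_cancel₀ hγ (by rw [hz, hl] at hC; linear_combination hC)) hz
    · exact F2' l hl (mul_left_cancel₀ hα (by rw [hz, hl] at hB; linear_combination hB)) hz
  · have hy : y = l * (α + γ) :=
      mul_left_cancel₀ hβγ (by rw [hl] at hB; linear_combination hB)
    by_cases hα : α = 0
    · subst hα
      rcases mul_eq_zero.mp L1 with hC | hC
      · exact F4' l hl hy (mul_left_cancel₀ hγ (by rw [hy] at hC; linear_combination -hC))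
      · exact F3' l hl hy (mul_left_cancel₀ hβ (by rw [hy, hl] at hC; linear_combination hC))
    · exact F3' l hl hy (mul_left_cancel₀ hα (by rw [hy, hl] at hA; linear_combination hA))
  · by_cases hD : 2 * α + β + γ = 0
    · have hγ' : γ = -2 * α - β := by linarith
      have hb : β = -α := by
        have : x * (β + α) = 0 := by
          subst hγ'; linear_combination (hB - hA) / 2
        rcases mul_eq_zero.mp this with h | h
        · exact absurd h hx0
        · linarith
      subst hb
      have hg : γ = -α := by linarith
      subst hg
      have hα : α ≠ 0 := by simpa using hβ
      have hxy : x = y + z := mul_left_cancel₀ hα (by linear_combination -hA)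
      refine hG (Or.inr (Or.inr (Or.inr (Or.inr ⟨by ring, by ring, hxy, ?_⟩))))
      have : c * (x * y * z) = 0 := by
        rw [hxy] at h1 ⊢; linear_combination h1 / 2
      exact (mul_eq_zero.mp this).resolve_right hx
    · obtain ⟨k, hk⟩ : ∃ k, x = k * (2 * α + β + γ) := ⟨x / (2 * α + β + γ), by field_simp⟩
      have hy : y = k * (α + γ) := by
        apply mul_left_cancel₀ hβγ; apply mul_left_cancel₀ hD
        rw [hk] at hA hB
        linear_combination (-(α + β + γ)) * hA + (-α) * hB
      have hz : z = k * (α + β) := by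
        apply mul_left_cancel₀ hβγ; apply mul_left_cancel₀ hD
        rw [hk] at hA hB
        linear_combination (-(α + β + γ)) * hB + (-α) * hA
      exact hG (Or.inl ⟨k, (F1 k hk hy hz).1, hk, hy, hz, (F1 k hk hy hz).2⟩)

/-- Theorem 5.16, Case 3 (`m ≤ p < q`), algebraic content: classification of nondegenerate
solutions of the reduced Einstein system with `b = 2(m−n)`,
`(c₁, c₂, c₃) = (p−m−n, m−n−p+q, 2m−q)`. -/
theorem einstein_classification_case3 (m n p q : ℕ) (hm : 1 ≤ m) (hn : 1 ≤ n)
    (hmn : 4 ≤ m + n) (hmn' : m = n → 3 ≤ n) (hmp : m ≤ p) (hpq : p < q)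
    (hq : q ≤ m + n - 1) (x₁ x₂ x₃ c : ℝ) (hx : x₁ * x₂ * x₃ ≠ 0) :
    EinsteinSystem (2 * ((m : ℝ) - n)) ((p : ℝ) - m - n) ((m : ℝ) - n - p + q)
        (2 * (m : ℝ) - q) x₁ x₂ x₃ c ↔
    ((∃ l : ℝ, l ≠ 0 ∧ x₁ = l * (3 * (m : ℝ) - n - p) ∧ x₂ = l * ((m : ℝ) - n - p + q) ∧
        x₃ = l * (2 * (m : ℝ) - q) ∧ c = 1 / l ∧
        (3 * (m : ℝ) - n - p) * ((m : ℝ) - n - p + q) * (2 * (m : ℝ) - q) ≠ 0) ∨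
     (∃ l : ℝ, l ≠ 0 ∧ x₁ = l * ((p : ℝ) - m - n) ∧ x₂ = l * ((m : ℝ) - n + p - q) ∧
        x₃ = l * (2 * (m : ℝ) - q) ∧ c = 1 / l ∧
        ((p : ℝ) - m - n) * ((m : ℝ) - n + p - q) * (2 * (m : ℝ) - q) ≠ 0) ∨
     (∃ l : ℝ, l ≠ 0 ∧ x₁ = l * ((p : ℝ) - m - n) ∧ x₂ = l * ((m : ℝ) - n - p + q) ∧
        x₃ = l * ((q : ℝ) - 2 * n) ∧ c = 1 / l ∧
        ((p : ℝ) - m - n) * ((m : ℝ) - n - p + q) * ((q : ℝ) - 2 * n) ≠ 0) ∨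
     (∃ l : ℝ, l ≠ 0 ∧ x₁ = l * ((p : ℝ) - m - n) ∧ x₂ = l * ((m : ℝ) - n - p + q) ∧
        x₃ = l * (2 * (m : ℝ) - q) ∧
        c = (1 + 2 * ((p : ℝ) - q) * ((m : ℝ) + n - q) * (2 * (m : ℝ) - p) /
              (((m : ℝ) + n - p) * ((m : ℝ) - n - p + q) * (2 * (m : ℝ) - q))) / l ∧
        ((p : ℝ) - m - n) * ((m : ℝ) - n - p + q) * (2 * (m : ℝ) - q) ≠ 0) ∨
     ((p : ℝ) = 3 * (m : ℝ) - n ∧ (q : ℝ) = 2 * m ∧ x₁ = x₂ + x₃ ∧ c = 0)) := by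
  have hpq' : (p : ℝ) < q := by exact_mod_cast hpq
  have hqmn : (q : ℝ) < m + n := by
    have : q < m + n := by omega
    exact_mod_cast this
  generalize (m : ℝ) = M at *
  generalize (n : ℝ) = N at *
  generalize (p : ℝ) = P at *
  generalize (q : ℝ) = Q at *
  unfold EinsteinSystem
  constructor
  · rintro ⟨h1, h2, h3⟩
    have key := core_forward (2 * M - P) (P - Q) (Q - M - N) x₁ x₂ x₃ c
      (by intro h; linarith) (by intro h; linarith) (by intro h; linarith) hx
      (by linear_combination h1 / 2) (by linear_combination h2 / 2) (by linear_combination h3 / 2)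
    rcases key with ⟨l, hl, rfl, rfl, rfl, hc⟩ | ⟨l, hl, rfl, rfl, rfl, hc⟩ |
      ⟨l, hl, rfl, rfl, rfl, hc⟩ | ⟨l, hl, rfl, rfl, rfl, hc⟩ | ⟨ha, hb, hxy, hc⟩
    · refine Or.inl ⟨l, hl, by ring, by ring, by ring, hc, fun h => hx ?_⟩
      linear_combination l ^ 3 * h
    · refine Or.inr (Or.inl ⟨l, hl, by ring, by ring, by ring, hc, fun h => hx ?_⟩)
      linear_combination l ^ 3 * h
    · refine Or.inr (Or.inr (Or.inl ⟨l, hl, by ring, by ring, by ring, hc, fun h => hx ?_⟩))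
      linear_combination l ^ 3 * h
    · refine Or.inr (Or.inr (Or.inr (Or.inl
        ⟨l, hl, by ring, by ring, by ring, ?_, fun h => hx ?_⟩)))
      · rw [hc]
        congr 2
        rw [← neg_div_neg_eq]
        congr 1 <;> ring
      · linear_combination l ^ 3 * h
    · exact Or.inr (Or.inr (Or.inr (Or.inr ⟨by linarith, by linarith, hxy, hc⟩)))
  · rintro (⟨l, hl, rfl, rfl, rfl, rfl, hP⟩ | ⟨l, hl, rfl, rfl, rfl, rfl, hP⟩ |
      ⟨l, hl, rfl, rfl, rfl, rfl, hP⟩ | ⟨l, hl, rfl, rfl, rfl, rfl, hP⟩ | ⟨rfl, rfl, rfl, rfl⟩)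
    · refine ⟨?_, ?_, ?_⟩ <;> field_simp <;> ring
    · refine ⟨?_, ?_, ?_⟩ <;> field_simp <;> ring
    · refine ⟨?_, ?_, ?_⟩ <;> field_simp <;> ring
    · have e1 : M + N - P ≠ 0 := by intro h; linarith
      have e2 : M - N - P + Q ≠ 0 := by rintro h; simp [h] at hP
      have e3 : 2 * M - Q ≠ 0 := by rintro h; simp [h] at hP
      refine ⟨?_, ?_, ?_⟩ <;> field_simp <;> ring
    · refine ⟨?_, ?_, ?_⟩ <;> ring
end

section
/- Let n, p be integers with 2 ≤ p ≤ n. Put b = −2n, c₁ = −n + (p − 1)/2, c₂ = −(p − 1). Then a triple (x₁, x₂, c) with x₁x₂ ≠ 0 satisfies the reduced Einstein system E_C(b; c₁, c₂) if and only if there exists λ ≠ 0 such that either (x₁, x₂) = λ(1, 2) and c = (−n + (p − 1)/2)/λ, or (x₁, x₂) = λ(2n + 1 − p, 2(p − 1)) and c = (−1/2 − (p − 1)(n + 1 − p)/(2n + 1 − p)²)/λ. -/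
/-- The reduced Einstein system `E_C(b; c₁, c₂)` in the unknowns `(x₁, x₂, c) ∈ ℝ³`: writing
`x² = 2x₁² + x₂²`, the two polynomial equations
`4c·x₁²x₂ = 2b·x₁x₂ + (b − 2c₁)(2x₁² − x²)` and
`4c·x₁²x₂ = 2b·x₁² + (b − 2c₂)(2x₂² − x²)`. -/
def EinsteinSystemC (b c₁ c₂ x₁ x₂ c : ℝ) : Prop :=
  4 * c * x₁ ^ 2 * x₂ = 2 * b * x₁ * x₂ + (b - 2 * c₁) * (2 * x₁ ^ 2 - (2 * x₁ ^ 2 + x₂ ^ 2)) ∧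
  4 * c * x₁ ^ 2 * x₂ = 2 * b * x₁ ^ 2 + (b - 2 * c₂) * (2 * x₂ ^ 2 - (2 * x₁ ^ 2 + x₂ ^ 2))

/-- Theorem 5.26, algebraic content: for `2 ≤ p ≤ n`, with `b = −2n`, `c₁ = −n + (p−1)/2`,
`c₂ = −(p−1)`, a triple `(x₁, x₂, c)` with `x₁x₂ ≠ 0` satisfies the reduced Einstein system
`E_C(b; c₁, c₂)` if and only if for some `λ ≠ 0` either `(x₁, x₂) = λ(1, 2)` with
`c = (−n + (p−1)/2)/λ`, or `(x₁, x₂) = λ(2n+1−p, 2(p−1))` with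
`c = (−1/2 − (p−1)(n+1−p)/(2n+1−p)²)/λ`. -/
theorem einsteinC_classification (n p : ℕ) (hp : 2 ≤ p) (hpn : p ≤ n)
    (x₁ x₂ c : ℝ) (hx : x₁ * x₂ ≠ 0) :
    EinsteinSystemC (-2 * (n : ℝ)) (-(n : ℝ) + ((p : ℝ) - 1) / 2) (-((p : ℝ) - 1))
        x₁ x₂ c ↔
    ∃ l : ℝ, l ≠ 0 ∧
      ((x₁ = l * 1 ∧ x₂ = l * 2 ∧ c = (-(n : ℝ) + ((p : ℝ) - 1) / 2) / l) ∨
       (x₁ = l * (2 * (n : ℝ) + 1 - p) ∧ x₂ = l * (2 * ((p : ℝ) - 1)) ∧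
        c = (-(1 : ℝ) / 2 - ((p : ℝ) - 1) * ((n : ℝ) + 1 - p) /
              (2 * (n : ℝ) + 1 - p) ^ 2) / l)) := by
  obtain ⟨h1, h2⟩ := mul_ne_zero_iff.mp hx
  have hp' : (2 : ℝ) ≤ p := by exact_mod_cast hp
  have hn' : (p : ℝ) ≤ n := by exact_mod_cast hpn
  have hm : (2 * (n : ℝ) + 1 - p) ≠ 0 := by intro h; linarith
  have hq : ((p : ℝ) - 1) ≠ 0 := by intro h; linarith
  generalize (n : ℝ) = N at *
  generalize (p : ℝ) = P at *
  unfold EinsteinSystemC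
  constructor
  · rintro ⟨e1, e2⟩
    have key : (x₂ - 2 * x₁) * ((2 * N + 1 - P) * x₂ - 2 * (P - 1) * x₁) = 0 := by
      linear_combination e2 - e1
    rcases mul_eq_zero.mp key with h | h
    · refine ⟨x₁, h1, Or.inl ⟨by ring, by linarith, ?_⟩⟩
      have hx2 : x₂ = 2 * x₁ := by linarith
      subst hx2
      rw [eq_div_iff h1]
      have h3 : (8 * x₁ ^ 2) ≠ 0 := by positivity
      apply mul_left_cancel₀ h3
      linear_combination e1
    · obtain ⟨l, hl⟩ : ∃ l, x₁ = l * (2 * N + 1 - P) :=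
        ⟨x₁ / (2 * N + 1 - P), by field_simp⟩
      have hx2 : x₂ = l * (2 * (P - 1)) := by
        apply mul_left_cancel₀ hm
        rw [hl] at h
        linear_combination h
      have hl0 : l ≠ 0 := by
        rintro rfl
        exact h1 (by rw [hl]; ring)
      refine ⟨l, hl0, Or.inr ⟨hl, hx2, ?_⟩⟩
      subst hx2
      subst hl
      rw [eq_div_iff hl0]
      have h3 : (8 * l ^ 2 * (P - 1)) ≠ 0 :=
        mul_ne_zero (by positivity) hq
      have e3 : c * l * (2 * N + 1 - P) ^ 2 =
          -(1 / 2) * (2 * N + 1 - P) ^ 2 - (P - 1) * (N + 1 - P) := by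
        apply mul_left_cancel₀ h3
        linear_combination e1
      have hm2 := pow_ne_zero 2 hm
      apply mul_right_cancel₀ hm2
      rw [e3, sub_mul (-1 / 2 : ℝ), div_mul_cancel₀ _ hm2]
      ring
  · rintro ⟨l, hl, ⟨rfl, rfl, rfl⟩ | ⟨rfl, rfl, rfl⟩⟩
    · constructor <;> field_simp <;> ring
    · constructor <;> field_simp <;> ring
end
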